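/- Let f ∈ C(x), let L = D + f, and let c ∈ C be a pole of f. If L is stable, then for every integer i ≥ 0 the equation -r' + f·r = x^i/(x - c) has a solution r ∈ C(x). -/

import Mathlib

open Polynomial

/-- The derivative of a rational function, computed via the quotient rule on the
reduced numerator/denominator representation. -/
noncomputable def rderiv {C : Type} [Field C] (f : RatFunc C) : RatFunc C :=
  algebraMap (Polynomial C) (RatFunc C)
      (derivative f.num * f.denom - f.num * derivative f.denom) /
    algebraMap (Polynomial C) (RatFunc C) (f.denom ^ 2)

/-- The adjoint of the first-order operator `D + f` applied to `r`: `L*(r) = -r' + f*r`. -/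
noncomputable def adjD {C : Type} [Field C] (f r : RatFunc C) : RatFunc C :=
  -rderiv r + f * r

/-- A linear differential operator with adjoint action `adj` on `C(x)` is stable if for
every `i ≥ 0` there is a polynomial of degree `i` in the image of the adjoint on `C(x)`. -/
def stableOf {C : Type} [Field C] (adj : RatFunc C → RatFunc C) : Prop :=
  ∀ i : ℕ, ∃ p : Polynomial C, p.degree = (i : ℕ) ∧
    ∃ r : RatFunc C, adj r = algebraMap (Polynomial C) (RatFunc C) p

theorem rderiv_div {C : Type} [Field C] (a b : C[X]) (hb : b ≠ 0) :
    rderiv (algebraMap C[X] (RatFunc C) a / algebraMap C[X] (RatFunc C) b) =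
      algebraMap C[X] (RatFunc C) (derivative a * b - a * derivative b) /
        algebraMap C[X] (RatFunc C) (b ^ 2) := by
  unfold rderiv
  set g := algebraMap C[X] (RatFunc C) a / algebraMap C[X] (RatFunc C) b with hg
  have hd : g.denom ≠ 0 := g.denom_ne_zero
  have hb' : algebraMap C[X] (RatFunc C) b ≠ 0 := RatFunc.algebraMap_ne_zero hb
  have hd' : algebraMap C[X] (RatFunc C) g.denom ≠ 0 := RatFunc.algebraMap_ne_zero hd
  have h : g.num * b = a * g.denom := by
    apply RatFunc.algebraMap_injective C
    rw [map_mul, map_mul, ← div_eq_div_iff hd' hb', RatFunc.num_div_denom]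
  have h' := congrArg derivative h
  simp only [derivative_mul] at h'
  rw [div_eq_div_iff (RatFunc.algebraMap_ne_zero (pow_ne_zero 2 hd))
    (RatFunc.algebraMap_ne_zero (pow_ne_zero 2 hb)), ← map_mul, ← map_mul]
  congr 1
  linear_combination (g.denom * b) * h' -
    (b * derivative g.denom + derivative b * g.denom) * h

theorem rderiv_algebraMap {C : Type} [Field C] (p : C[X]) :
    rderiv (algebraMap C[X] (RatFunc C) p) = algebraMap C[X] (RatFunc C) (derivative p) := by
  simpa using rderiv_div p 1 one_ne_zero

theorem rderiv_add {C : Type} [Field C] (r s : RatFunc C) :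
    rderiv (r + s) = rderiv r + rderiv s := by
  have hr := RatFunc.algebraMap_ne_zero r.denom_ne_zero
  have hs := RatFunc.algebraMap_ne_zero s.denom_ne_zero
  have h : r + s = algebraMap C[X] (RatFunc C) (r.num * s.denom + r.denom * s.num) /
      algebraMap C[X] (RatFunc C) (r.denom * s.denom) := by
    rw [map_add, map_mul, map_mul, map_mul, ← div_add_div _ _ hr hs, r.num_div_denom,
      s.num_div_denom]
  rw [h, rderiv_div _ _ (mul_ne_zero r.denom_ne_zero s.denom_ne_zero)]
  unfold rderiv
  simp only [derivative_mul, map_add, map_sub, map_mul, map_pow]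
  field_simp
  ring

theorem rderiv_C_mul {C : Type} [Field C] (a : C) (r : RatFunc C) :
    rderiv (RatFunc.C a * r) = RatFunc.C a * rderiv r := by
  have h : RatFunc.C a * r = algebraMap C[X] (RatFunc C) (Polynomial.C a * r.num) /
      algebraMap C[X] (RatFunc C) r.denom := by
    rw [map_mul, RatFunc.algebraMap_C, mul_div_assoc, r.num_div_denom]
  rw [h, rderiv_div _ _ r.denom_ne_zero]
  unfold rderiv
  rw [← RatFunc.algebraMap_C, ← mul_div_assoc, ← map_mul, derivative_C_mul]
  congr 2
  ring

theorem adjD_add {C : Type} [Field C] (f r s : RatFunc C) :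
    adjD f (r + s) = adjD f r + adjD f s := by
  unfold adjD
  rw [rderiv_add]
  ring

theorem adjD_C_mul {C : Type} [Field C] (f : RatFunc C) (a : C) (r : RatFunc C) :
    adjD f (RatFunc.C a * r) = RatFunc.C a * adjD f r := by
  unfold adjD
  rw [rderiv_C_mul]
  ring

theorem exists_adjD_eq_polynomial {C : Type} [Field C] (f : RatFunc C)
    (hst : stableOf (adjD f)) (p : C[X]) :
    ∃ r : RatFunc C, adjD f r = algebraMap C[X] (RatFunc C) p := by
  induction hp : p.degree using WellFoundedLT.induction generalizing p with
  | ind n ih =>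
  subst hp
  rcases eq_or_ne p 0 with rfl | hp0
  · exact ⟨RatFunc.C 0 * 0, by rw [adjD_C_mul]; simp⟩
  obtain ⟨q, hq, s, hs⟩ := hst p.natDegree
  rw [← degree_eq_natDegree hp0] at hq
  have hq0 : q ≠ 0 := by
    rintro rfl
    exact hp0 (degree_eq_bot.mp (by rw [← hq, degree_zero]))
  have ha : p.leadingCoeff / q.leadingCoeff ≠ 0 :=
    div_ne_zero (leadingCoeff_ne_zero.mpr hp0) (leadingCoeff_ne_zero.mpr hq0)
  set a := p.leadingCoeff / q.leadingCoeff with ha'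
  have hlt : (p - Polynomial.C a * q).degree < p.degree := by
    refine degree_sub_lt_left (by rw [degree_C_mul ha, hq]) hp0 ?_
    rw [leadingCoeff_mul, leadingCoeff_C, ha',
      div_mul_cancel₀ _ (leadingCoeff_ne_zero.mpr hq0)]
  obtain ⟨t, ht⟩ := ih _ hlt _ rfl
  refine ⟨t + RatFunc.C a * s, ?_⟩
  rw [adjD_add, adjD_C_mul, ht, hs, ← RatFunc.algebraMap_C, ← map_mul, ← map_add,
    sub_add_cancel]

/-- Lemma 4.8(2). Let `c` be a pole of `f`. If `L = D + f` is stable,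
then for every `i ≥ 0` the equation `-r' + f*r = x^i/(x-c)` has a rational solution. -/
theorem stable_solution_power_over_linear {C : Type} [Field C] [IsAlgClosed C] [CharZero C]
    (f : RatFunc C) (c : C) (hc : f.denom.eval c = 0) (hst : stableOf (adjD f)) :
    ∀ i : ℕ, ∃ r : RatFunc C,
      adjD f r = RatFunc.X ^ i / (RatFunc.X - RatFunc.C c) := by
  intro i
  have hn : f.num.eval c ≠ 0 := by
    intro h
    obtain ⟨u, v, huv⟩ := f.isCoprime_num_denom
    simpa [h, hc] using congrArg (Polynomial.eval c) huv
  obtain ⟨e, he⟩ := dvd_iff_isRoot.mpr hc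
  obtain ⟨g, hg⟩ := X_sub_C_dvd_sub_C_eval (a := c) (p := f.num)
  obtain ⟨h, hh⟩ := X_sub_C_dvd_sub_C_eval (a := c) (p := (X ^ i : C[X]))
  simp only [eval_pow, eval_X] at hh
  set a := c ^ i / f.num.eval c with ha
  have han : a * f.num.eval c = c ^ i := div_mul_cancel₀ _ hn
  obtain ⟨t, ht⟩ := exists_adjD_eq_polynomial f hst
    (h + Polynomial.C a * (derivative e - g))
  refine ⟨t + RatFunc.C a * algebraMap C[X] (RatFunc C) e, ?_⟩
  have hd0 : algebraMap C[X] (RatFunc C) f.denom ≠ 0 :=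
    RatFunc.algebraMap_ne_zero f.denom_ne_zero
  have hx0 : algebraMap C[X] (RatFunc C) (X - Polynomial.C c) ≠ 0 :=
    RatFunc.algebraMap_ne_zero (X_sub_C_ne_zero c)
  have hfe : f * algebraMap C[X] (RatFunc C) e =
      algebraMap C[X] (RatFunc C) f.num / algebraMap C[X] (RatFunc C) (X - Polynomial.C c) := by
    rw [eq_div_iff hx0, mul_assoc, ← map_mul, mul_comm e, ← he]
    nth_rewrite 1 [← f.num_div_denom]
    rw [div_mul_cancel₀ _ hd0]
  rw [adjD_add, adjD_C_mul, ht, adjD, rderiv_algebraMap, hfe, ← RatFunc.algebraMap_X,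
    ← RatFunc.algebraMap_C, ← RatFunc.algebraMap_C, ← map_sub, ← map_pow, eq_div_iff hx0]
  rw [add_mul, mul_assoc, add_mul, div_mul_cancel₀ _ hx0]
  simp only [← map_mul, ← map_add, ← map_neg]
  congr 1
  have hanC : Polynomial.C a * Polynomial.C (f.num.eval c) = Polynomial.C (c ^ i) := by
    rw [← Polynomial.C_mul, han]
  rw [derivative_neg]
  linear_combination -hh + Polynomial.C a * hg + hanC
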